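/- For every integrable random variable Y, every α ∈ [0,1) and every β ∈ [0,1), the higher order average value-at-risk is again an average value-at-risk: inf_{t ∈ ℝ} ( t + (1−β)^{-1}·AVaR_α((Y−t)₊) ) = AVaR_{1−(1−α)(1−β)}(Y). -/

import Mathlib

open MeasureTheory Set

/-- Cumulative distribution function `F_Y(x) = P(Y ≤ x)`. -/
noncomputable def cdfR {Ω : Type*} [MeasurableSpace Ω] (P : Measure Ω) (Y : Ω → ℝ)
    (x : ℝ) : ℝ :=
  (P {ω | Y ω ≤ x}).toReal

/-- Quantile function `F_Y⁻¹(u) = inf {x : F_Y(x) ≥ u}`. -/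
noncomputable def quantR {Ω : Type*} [MeasurableSpace Ω] (P : Measure Ω) (Y : Ω → ℝ)
    (u : ℝ) : ℝ :=
  sInf {x : ℝ | u ≤ cdfR P Y x}

/-- Average value-at-risk `AVaR_α(Y) = (1-α)⁻¹ ∫_α^1 F_Y⁻¹(u) du`. -/
noncomputable def avarR {Ω : Type*} [MeasurableSpace Ω] (P : Measure Ω) (α : ℝ)
    (Y : Ω → ℝ) : ℝ :=
  (1 - α)⁻¹ * ∫ u in α..1, quantR P Y u

open Filter Topology

lemma cdfR_eq {Ω : Type*} [MeasurableSpace Ω] (P : Measure Ω) [IsProbabilityMeasure P]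
    (Y : Ω → ℝ) (hY : AEMeasurable Y P) (x : ℝ) :
    cdfR P Y x = ProbabilityTheory.cdf (P.map Y) x := by
  have : IsProbabilityMeasure (P.map Y) := Measure.isProbabilityMeasure_map hY
  rw [ProbabilityTheory.cdf_eq_real, Measure.real,
    Measure.map_apply_of_aemeasurable hY measurableSet_Iic]
  rfl

lemma quantR_le_iff {Ω : Type*} [MeasurableSpace Ω] (P : Measure Ω) [IsProbabilityMeasure P]
    (Y : Ω → ℝ) (hY : AEMeasurable Y P) {u : ℝ} (hu : u ∈ Ioo (0 : ℝ) 1) (x : ℝ) :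
    quantR P Y u ≤ x ↔ u ≤ cdfR P Y x := by
  have : IsProbabilityMeasure (P.map Y) := Measure.isProbabilityMeasure_map hY
  unfold quantR
  simp only [cdfR_eq P Y hY]
  set F := ProbabilityTheory.cdf (P.map Y) with hF
  have hbdd : BddBelow {x : ℝ | u ≤ F x} := by
    have h := (ProbabilityTheory.tendsto_cdf_atBot (P.map Y)).eventually (gt_mem_nhds hu.1)
    obtain ⟨a, ha⟩ := h.exists
    refine ⟨a, fun y hy => ?_⟩
    by_contra hlt
    have h1 : F y ≤ F a := F.mono (not_le.mp hlt).le
    have h2 : u ≤ F y := hy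
    linarith
  have hne : {x : ℝ | u ≤ F x}.Nonempty := by
    have h := (ProbabilityTheory.tendsto_cdf_atTop (P.map Y)).eventually (lt_mem_nhds hu.2)
    obtain ⟨a, ha⟩ := h.exists
    exact ⟨a, le_of_lt ha⟩
  constructor
  · intro h
    have hc : Tendsto F (𝓝[>] x) (𝓝 (F x)) :=
      (F.right_continuous x).tendsto.mono_left (nhdsWithin_mono _ Ioi_subset_Ici_self)
    refine ge_of_tendsto hc ?_
    filter_upwards [self_mem_nhdsWithin] with y hy
    obtain ⟨z, hz, hzy⟩ := exists_lt_of_csInf_lt hne (lt_of_le_of_lt h hy)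
    exact le_trans hz (F.mono hzy.le)
  · intro h
    exact csInf_le hbdd h

lemma quantR_mono {Ω : Type*} [MeasurableSpace Ω] (P : Measure Ω) [IsProbabilityMeasure P]
    (Y : Ω → ℝ) (hY : AEMeasurable Y P) : MonotoneOn (quantR P Y) (Ioo (0 : ℝ) 1) := by
  intro u hu v hv huv
  rw [quantR_le_iff P Y hY hu]
  exact huv.trans ((quantR_le_iff P Y hY hv _).1 le_rfl)

lemma quantR_pos_part {Ω : Type*} [MeasurableSpace Ω] (P : Measure Ω) [IsProbabilityMeasure P]
    (Y : Ω → ℝ) (hY : AEMeasurable Y P) (t : ℝ) {u : ℝ} (hu : u ∈ Ioo (0 : ℝ) 1) :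
    quantR P (fun ω => max (Y ω - t) 0) u = max (quantR P Y u - t) 0 := by
  have hZ : AEMeasurable (fun ω => max (Y ω - t) 0) P :=
    (hY.sub_const t).max aemeasurable_const
  refine eq_of_forall_ge_iff fun x => ?_
  rw [quantR_le_iff P _ hZ hu, max_le_iff, sub_le_iff_le_add, quantR_le_iff P Y hY hu]
  unfold cdfR
  simp only [max_le_iff, sub_le_iff_le_add]
  by_cases hx : 0 ≤ x
  · simp [hx]
  · simp [hx, hu.1]

lemma quantR_integrable {Ω : Type*} [MeasurableSpace Ω] (P : Measure Ω) [IsProbabilityMeasure P]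
    (Y : Ω → ℝ) (hY : Integrable Y P) : IntegrableOn (quantR P Y) (Ioo (0 : ℝ) 1) := by
  have hYm := hY.aemeasurable
  have : IsProbabilityMeasure (P.map Y) := Measure.isProbabilityMeasure_map hYm
  have hq : AEMeasurable (quantR P Y) (volume.restrict (Ioo (0 : ℝ) 1)) :=
    aemeasurable_restrict_of_monotoneOn measurableSet_Ioo (quantR_mono P Y hYm)
  have hmap : (volume.restrict (Ioo (0 : ℝ) 1)).map (quantR P Y) = P.map Y := by
    have : IsFiniteMeasure ((volume.restrict (Ioo (0 : ℝ) 1)).map (quantR P Y)) :=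
      inferInstance
    refine Measure.ext_of_Iic _ _ fun x => ?_
    rw [Measure.map_apply_of_aemeasurable hq measurableSet_Iic,
      Measure.map_apply_of_aemeasurable hYm measurableSet_Iic]
    rw [Measure.restrict_apply' measurableSet_Ioo]
    have h1 : quantR P Y ⁻¹' Iic x ∩ Ioo 0 1 = Iic (cdfR P Y x) ∩ Ioo 0 1 := by
      ext u
      simp only [mem_inter_iff, mem_preimage, mem_Iic, and_congr_left_iff]
      exact fun hu => quantR_le_iff P Y hYm hu x
    have h2 : volume (Iic (cdfR P Y x) ∩ Ioo 0 1) = volume (Iic (cdfR P Y x) ∩ Ioc 0 1) :=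
      measure_congr ((ae_eq_refl _).inter Ioo_ae_eq_Ioc)
    have h3 : Iic (cdfR P Y x) ∩ Ioc 0 1 = Ioc 0 (cdfR P Y x) := by
      have hle : cdfR P Y x ≤ 1 := by
        rw [cdfR_eq P Y hYm]; exact ProbabilityTheory.cdf_le_one _ _
      ext u
      simp only [mem_inter_iff, mem_Iic, mem_Ioc]
      constructor
      · rintro ⟨a, b, c⟩; exact ⟨b, a⟩
      · rintro ⟨a, b⟩; exact ⟨b, a, b.trans hle⟩
    rw [h1, h2, h3, Real.volume_Ioc, sub_zero, cdfR, ENNReal.ofReal_toReal (measure_ne_top _ _)]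
    rfl
  have h1 : Integrable id (P.map Y) :=
    (integrable_map_measure aestronglyMeasurable_id hYm).2 hY
  rw [← hmap] at h1
  exact (integrable_map_measure aestronglyMeasurable_id hq).1 h1

lemma avarR_pos_part {Ω : Type*} [MeasurableSpace Ω] (P : Measure Ω) [IsProbabilityMeasure P]
    (Y : Ω → ℝ) (hY : AEMeasurable Y P) (α : ℝ) (hα : α ∈ Set.Ico (0 : ℝ) 1) (t : ℝ) :
    avarR P α (fun ω => max (Y ω - t) 0) =
      (1 - α)⁻¹ * ∫ u in Ioo α 1, max (quantR P Y u - t) 0 := by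
  unfold avarR
  rw [intervalIntegral.integral_of_le hα.2.le, integral_Ioc_eq_integral_Ioo]
  congr 1
  refine setIntegral_congr_fun measurableSet_Ioo fun u hu => ?_
  exact quantR_pos_part P Y hY t ⟨hα.1.trans_lt hu.1, hu.2⟩

theorem stmt6 {Ω : Type*} [MeasurableSpace Ω] (P : Measure Ω) [IsProbabilityMeasure P]
    (Y : Ω → ℝ) (hY : Integrable Y P)
    (α : ℝ) (hα : α ∈ Set.Ico (0 : ℝ) 1) (β : ℝ) (hβ : β ∈ Set.Ico (0 : ℝ) 1) :
    (⨅ t : ℝ, t + (1 - β)⁻¹ * avarR P α (fun ω => max (Y ω - t) 0)) =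
      avarR P (1 - (1 - α) * (1 - β)) Y := by
  have hYm := hY.aemeasurable
  simp only [avarR_pos_part P Y hYm α hα]
  obtain ⟨hα0, hα1⟩ := hα
  obtain ⟨hβ0, hβ1⟩ := hβ
  set γ := 1 - (1 - α) * (1 - β) with hγ
  have hαγ : α ≤ γ := by nlinarith
  have hγ1 : γ < 1 := by nlinarith
  have hγ0 : 0 ≤ γ := hα0.trans hαγ
  have hmono := quantR_mono P Y hYm
  have hint := quantR_integrable P Y hY
  unfold avarR
  rw [intervalIntegral.integral_of_le hγ1.le, integral_Ioc_eq_integral_Ioo]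
  set q := quantR P Y
  set c := (1 - γ)⁻¹ with hc
  have hcpos : 0 < c := inv_pos.2 (by linarith)
  have hc1 : c * (1 - γ) = 1 := inv_mul_cancel₀ (by linarith)
  have hcc : ∀ x : ℝ, (1 - β)⁻¹ * ((1 - α)⁻¹ * x) = c * x := by
    intro x
    rw [← mul_assoc, ← mul_inv, hc, hγ]
    congr 2; ring
  simp only [hcc]
  have hintα : ∀ t, IntegrableOn (fun u => max (q u - t) 0) (Ioo α 1) := fun t =>
    ((hint.mono_set (Ioo_subset_Ioo_left hα0)).sub
      (integrableOn_const (by simp))).pos_part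
  have hintγ : IntegrableOn q (Ioo γ 1) := hint.mono_set (Ioo_subset_Ioo_left hγ0)
  have hconst : ∀ t : ℝ, IntegrableOn (fun _ : ℝ => t) (Ioo γ 1) := fun t =>
    integrableOn_const (by simp)
  have hsub : ∀ t, t + c * ∫ u in Ioo γ 1, (q u - t) = c * ∫ u in Ioo γ 1, q u := by
    intro t
    rw [integral_sub hintγ (hconst t)]
    simp only [setIntegral_const, Measure.real, Real.volume_Ioo, smul_eq_mul]
    rw [ENNReal.toReal_ofReal (by linarith)]
    linear_combination -t * hc1
  have hlow : ∀ t, c * ∫ u in Ioo γ 1, q u ≤ t + c * ∫ u in Ioo α 1, max (q u - t) 0 := by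
    intro t
    rw [← hsub t]
    gcongr
    calc ∫ u in Ioo γ 1, (q u - t) ≤ ∫ u in Ioo γ 1, max (q u - t) 0 :=
          setIntegral_mono (hintγ.sub (hconst t))
            ((hintα t).mono_set (Ioo_subset_Ioo_left hαγ)) fun u => le_max_left _ _
      _ ≤ _ := setIntegral_mono_set (hintα t) (ae_of_all _ fun u => le_max_right _ _)
            (Ioo_subset_Ioo_left hαγ).eventuallyLE
  have hbdd : BddBelow (range fun t => t + c * ∫ u in Ioo α 1, max (q u - t) 0) :=
    ⟨_, by rintro _ ⟨t, rfl⟩; exact hlow t⟩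
  refine le_antisymm ?_ (le_ciInf hlow)
  rcases hγ0.eq_or_lt with h0 | hpos
  · have hα' : α = γ := le_antisymm hαγ (by linarith)
    rw [hα'] at hbdd hintα ⊢
    have hmax : ∀ t, t + c * ∫ u in Ioo γ 1, max (q u - t) 0 =
        c * ∫ u in Ioo γ 1, max (q u) t := by
      intro t
      have h1 : ∀ u, max (q u) t = max (q u - t) 0 + t := by
        intro u; rw [max_add]; simp
      simp only [h1]
      rw [integral_add (hintα t) (hconst t)]
      simp only [setIntegral_const, Measure.real, Real.volume_Ioo, smul_eq_mul]
      rw [ENNReal.toReal_ofReal (by linarith)]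
      linear_combination -t * hc1
    have hlim : Tendsto (fun n : ℕ => ∫ u in Ioo γ 1, max (q u) (-(n : ℝ))) atTop
        (𝓝 (∫ u in Ioo γ 1, q u)) := by
      refine tendsto_integral_of_dominated_convergence (fun u => |q u|) ?_ hintγ.abs ?_ ?_
      · intro n
        exact (hintγ.sup (hconst _)).aestronglyMeasurable
      · intro n
        refine ae_of_all _ fun u => ?_
        rw [Real.norm_eq_abs, abs_le]
        exact ⟨(neg_abs_le _).trans (le_max_left _ _),
          max_le (le_abs_self _) ((neg_nonpos.2 n.cast_nonneg).trans (abs_nonneg _))⟩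
      · refine ae_of_all _ fun u => ?_
        obtain ⟨N, hN⟩ := exists_nat_ge (-(q u))
        refine tendsto_const_nhds.congr' ?_
        filter_upwards [eventually_ge_atTop N] with n hn
        have : (N : ℝ) ≤ n := by exact_mod_cast hn
        rw [max_eq_left (by linarith)]
    refine ge_of_tendsto (hlim.const_mul c) (Eventually.of_forall fun n => ?_)
    rw [← hmax]
    exact ciInf_le hbdd _
  · refine (ciInf_le hbdd (q γ)).trans ?_
    rw [← hsub (q γ)]
    gcongr
    refine le_of_eq ?_
    have h1 : ∫ u in Ioo α 1, max (q u - q γ) 0 = ∫ u in Ioo γ 1, max (q u - q γ) 0 := by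
      refine setIntegral_eq_of_subset_of_forall_diff_eq_zero measurableSet_Ioo
        (Ioo_subset_Ioo_left hαγ) fun u hu => ?_
      obtain ⟨⟨hu1, hu2⟩, hu3⟩ := hu
      have hle : u ≤ γ := by
        by_contra h
        exact hu3 ⟨not_le.1 h, hu2⟩
      have := hmono ⟨hα0.trans_lt hu1, hu2⟩ ⟨hpos, hγ1⟩ hle
      exact max_eq_right (by linarith)
    rw [h1]
    refine setIntegral_congr_fun measurableSet_Ioo fun u hu => ?_
    have := hmono ⟨hpos, hγ1⟩ ⟨hpos.trans hu.1, hu.2⟩ hu.1.le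
    exact max_eq_left (by linarith)
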